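/- The kernel of the homomorphism Ω : G → SL(2,ℤ) is a free group of rank two, freely generated by τ_m = b·c⁻¹ and τ_l = τ_m⁻¹·a·τ_m·a⁻¹; that is, there is an isomorphism from the free group on two generators onto the subgroup ker Ω of G sending the two free generators to τ_m and τ_l respectively. -/

import Mathlib

/-- `SL2Z` is the group of 2×2 integer matrices of determinant 1. -/
abbrev SL2Z := Matrix.SpecialLinearGroup (Fin 2) ℤ

/-- The matrix A = [[1,0],[1,1]]. -/
def matA : SL2Z := ⟨!![1, 0; 1, 1], by norm_num [Matrix.det_fin_two_of]⟩

/-- The matrix B = [[1,-1],[0,1]]. -/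
def matB : SL2Z := ⟨!![1, -1; 0, 1], by norm_num [Matrix.det_fin_two_of]⟩

/-- The four relators of the presentation of `PMCG₂(T)`:
`a·b·a·b⁻¹·a⁻¹·b⁻¹`, `a·c·a·c⁻¹·a⁻¹·c⁻¹`, `b·c·b⁻¹·c⁻¹`, `(a·b·c)⁴`,
where `a, b, c` are the generators `0, 1, 2`. -/
def pmcgRels : Set (FreeGroup (Fin 3)) :=
  { FreeGroup.of 0 * FreeGroup.of 1 * FreeGroup.of 0 *
      (FreeGroup.of 1)⁻¹ * (FreeGroup.of 0)⁻¹ * (FreeGroup.of 1)⁻¹,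
    FreeGroup.of 0 * FreeGroup.of 2 * FreeGroup.of 0 *
      (FreeGroup.of 2)⁻¹ * (FreeGroup.of 0)⁻¹ * (FreeGroup.of 2)⁻¹,
    FreeGroup.of 1 * FreeGroup.of 2 * (FreeGroup.of 1)⁻¹ * (FreeGroup.of 2)⁻¹,
    (FreeGroup.of 0 * FreeGroup.of 1 * FreeGroup.of 2) ^ 4 }

/-- `G = ⟨a, b, c | a·b·a = b·a·b, a·c·a = c·a·c, b·c = c·b, (a·b·c)⁴ = 1⟩`,
a presentation of `PMCG₂(T)`. -/
abbrev G := PresentedGroup pmcgRels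

/-- The generator `a` (the Dehn twist `t_α`). -/
def ga : G := PresentedGroup.of 0
/-- The generator `b` (the Dehn twist `t_β`). -/
def gb : G := PresentedGroup.of 1
/-- The generator `c` (the Dehn twist `t_γ`). -/
def gc : G := PresentedGroup.of 2

/-- `τ_m = b·c⁻¹`. -/
def τm : G := gb * gc⁻¹

/-- `τ_l = τ_m⁻¹·a·τ_m·a⁻¹`. -/
def τl : G := τm⁻¹ * ga * τm * ga⁻¹

namespace FreeGroup

theorem eq_one_of_forall_commute_of {α : Type*} [DecidableEq α] [Nontrivial α] {g : FreeGroup α}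
    (h : ∀ i, Commute (of i) g) : g = 1 := by
  by_contra hg
  have hW : g.toWord ≠ [] := by simpa using hg
  obtain ⟨j, hj⟩ := exists_ne (g.toWord.head hW).1
  set d := (g.toWord.getLast hW).2 with hd
  have hcomm : Commute (mk [(j, d)]) g := by
    cases d with
    | true => exact h j
    | false => simpa [of, invRev] using (h j).inv_left
  have hl : IsReduced ((j, d) :: g.toWord) := by
    rw [IsReduced, List.isChain_cons]
    refine ⟨fun y hy hjy => ?_, isReduced_toWord⟩
    rw [List.head?_eq_some_head hW, Option.mem_def, Option.some.injEq] at hy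
    exact absurd (hjy.trans (by rw [hy])) hj
  have hr : IsReduced (g.toWord ++ [(j, d)]) := by
    rw [IsReduced, List.isChain_append]
    refine ⟨isReduced_toWord, List.isChain_singleton _, fun x hx y hy _ => ?_⟩
    rw [List.getLast?_eq_some_getLast hW, Option.mem_def, Option.some.injEq] at hx
    simp only [List.head?_cons, Option.mem_def, Option.some.injEq] at hy
    rw [← hy, ← hx]
  have key : (j, d) :: g.toWord = g.toWord ++ [(j, d)] := by
    rw [← hl.reduce_eq, ← hr.reduce_eq, ← toWord_mk, ← toWord_mk]
    congr 1
    rw [← List.singleton_append, ← mul_mk, ← mul_mk, mk_toWord]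
    exact hcomm.eq
  have := congrArg List.head? key
  rw [List.head?_append, List.head?_eq_some_head hW] at this
  simp only [List.head?_cons, Option.some_or, Option.some.injEq] at this
  exact hj (by rw [← this])

end FreeGroup

section ModularGroup

variable {H : Type*} [Group H] {a b : H}

/-- The product of the letters `a` (for `true`) and `b⁻¹` (for `false`) of a binary word. -/
def twistWord (a b : H) (l : List Bool) : H :=
  (l.map fun t => cond t a b⁻¹).prod

theorem braid_sq_eq (hbraid : a * b * a = b * a * b) : (a * b * a) ^ 2 = (a * b) ^ 3 := by
  calc (a * b * a) ^ 2 = a * b * a * (a * b * a) := pow_two _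
    _ = a * b * a * (b * a * b) := by rw [← hbraid]
    _ = (a * b) ^ 3 := by simp only [pow_succ, pow_zero, one_mul, mul_assoc]

theorem exists_braid_normal_form (hbraid : a * b * a = b * a * b) (hord : (a * b) ^ 6 = 1)
    (hgen : Subgroup.closure {a, b} = ⊤) (h : H) :
    ∃ (n k : ℕ) (l : List Bool), h = (a * b * a) ^ n * twistWord a b l * (a * b) ^ k := by
  set X : H → Prop := fun h =>
    ∃ (n k : ℕ) (l : List Bool), h = (a * b * a) ^ n * twistWord a b l * (a * b) ^ k
  have hsq := braid_sq_eq hbraid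
  have hcomm (m : ℕ) : a * b * (a * b * a) ^ (2 * m) = (a * b * a) ^ (2 * m) * (a * b) := by
    rw [pow_mul, hsq]
    exact (((Commute.refl (a * b)).pow_right 3).pow_right m).eq
  have hflip : a * b * (a * b * a) = (a * b * a) ^ 2 * b⁻¹ := by
    rw [eq_mul_inv_iff_mul_eq, pow_two]
    nth_rewrite 3 [hbraid]
    simp only [mul_assoc]
  have hs {x : H} : X x → X (a * b * a * x) := by
    rintro ⟨n, k, l, rfl⟩
    exact ⟨n + 1, k, l, by simp only [pow_succ', mul_assoc]⟩
  have hu {x : H} : X x → X (a * b * x) := by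
    rintro ⟨n, k, l, rfl⟩
    obtain ⟨m, rfl | rfl⟩ := n.even_or_odd'
    · match l with
      | [] =>
        refine ⟨2 * m, k + 1, [], ?_⟩
        simp only [twistWord, List.map_nil, List.prod_nil, mul_one]
        rw [← mul_assoc, hcomm, pow_succ', mul_assoc]
      | true :: l =>
        refine ⟨2 * m + 1, k, l, ?_⟩
        simp only [twistWord, List.map_cons, List.prod_cons, cond_true]
        rw [← mul_assoc, ← mul_assoc, hcomm, pow_succ]
        simp only [mul_assoc]
      | false :: l =>
        refine ⟨2 * m, k, true :: l, ?_⟩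
        simp only [twistWord, List.map_cons, List.prod_cons, cond_true, cond_false]
        rw [← mul_assoc, ← mul_assoc, hcomm]
        simp only [mul_assoc, mul_inv_cancel_left]
    · refine ⟨2 * m + 2, k, false :: l, ?_⟩
      simp only [twistWord, List.map_cons, List.prod_cons, cond_false]
      rw [pow_succ, pow_add _ _ 2, ← mul_assoc, ← mul_assoc, ← mul_assoc, hcomm,
        mul_assoc (_ ^ (2 * m)) (a * b), hflip]
      simp only [mul_assoc]
  have hu' {x : H} (hx : X x) : X ((a * b)⁻¹ * x) := by
    have : (a * b)⁻¹ * x = a * b * (a * b * (a * b * (a * b * (a * b * x)))) := by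
      rw [inv_mul_eq_iff_eq_mul]
      calc x = (a * b) ^ 6 * x := by rw [hord, one_mul]
        _ = _ := by simp only [pow_succ, pow_zero, one_mul, mul_assoc]
    rw [this]
    exact hu (hu (hu (hu (hu hx))))
  have hs' {x : H} (hx : X x) : X ((a * b * a)⁻¹ * x) := by
    have : (a * b * a)⁻¹ * x = a * b * a * (a * b * a * (a * b * a * x)) := by
      rw [inv_mul_eq_iff_eq_mul]
      calc x = ((a * b * a) ^ 2) ^ 2 * x := by rw [hsq, ← pow_mul, hord, one_mul]
        _ = _ := by simp only [pow_succ, pow_zero, one_mul, mul_assoc]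
    rw [this]
    exact hs (hs (hs hx))
  have hmem : h ∈ Subgroup.closure {a, b} := hgen ▸ Subgroup.mem_top h
  induction hmem using Subgroup.closure_induction_left with
  | one => exact ⟨0, 0, [], by simp [twistWord]⟩
  | mul_left x hx y _ ih =>
    rcases hx with rfl | rfl
    · have := hu' (hs ih)
      rwa [← mul_assoc, inv_mul_cancel_left] at this
    · have := hs (hu' ih)
      rwa [hbraid, mul_inv_rev, ← mul_assoc, mul_assoc (x * a), mul_inv_cancel_left,
        mul_inv_cancel_right] at this
  | inv_mul_cancel x hx y _ ih =>
    rcases hx with rfl | rfl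
    · have := hs' (hu ih)
      rwa [← mul_assoc, mul_inv_rev, mul_assoc x⁻¹, inv_mul_cancel, mul_one] at this
    · have hx : x⁻¹ * y = a * x * ((a * x * a)⁻¹ * y) := by rw [hbraid]; group
      rw [hx]
      exact hu (hs' ih)

theorem map_twistWord {K : Type*} [Group K] (f : H →* K) (l : List Bool) :
    f (twistWord a b l) = twistWord (f a) (f b) l := by
  induction l with
  | nil => simp [twistWord]
  | cons t l ih => cases t <;> simp_all [twistWord]

theorem coe_matA : (matA : Matrix (Fin 2) (Fin 2) ℤ) = !![1, 0; 1, 1] := rfl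

theorem coe_matB : (matB : Matrix (Fin 2) (Fin 2) ℤ) = !![1, -1; 0, 1] := rfl

theorem matA_mul_zero (M : SL2Z) (j : Fin 2) : (matA * M) 0 j = M 0 j := by
  simp [coe_matA, Matrix.mul_apply, Fin.sum_univ_two]

theorem matA_mul_one (M : SL2Z) (j : Fin 2) : (matA * M) 1 j = M 0 j + M 1 j := by
  simp [coe_matA, Matrix.mul_apply, Fin.sum_univ_two]

theorem matB_inv_mul_zero (M : SL2Z) (j : Fin 2) : (matB⁻¹ * M) 0 j = M 0 j + M 1 j := by
  simp [coe_matB, Matrix.mul_apply, Fin.sum_univ_two]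

theorem matB_inv_mul_one (M : SL2Z) (j : Fin 2) : (matB⁻¹ * M) 1 j = M 1 j := by
  simp [coe_matB, Matrix.mul_apply, Fin.sum_univ_two]

theorem twistWord_matA_matB_entries (l : List Bool) :
    1 ≤ (twistWord matA matB l) 0 0 ∧ 1 ≤ (twistWord matA matB l) 1 1 ∧
      0 ≤ (twistWord matA matB l) 0 1 ∧ 0 ≤ (twistWord matA matB l) 1 0 ∧
      (l = [] ∨ 1 ≤ (twistWord matA matB l) 0 1 + (twistWord matA matB l) 1 0) := by
  induction l with
  | nil => simp [twistWord]
  | cons t l ih =>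
    obtain ⟨h₁, h₂, h₃, h₄, -⟩ := ih
    have hcons : twistWord matA matB (t :: l) = cond t matA matB⁻¹ * twistWord matA matB l := by
      simp [twistWord]
    rw [hcons]
    generalize twistWord matA matB l = M at *
    cases t <;> simp only [cond_true, cond_false, matA_mul_zero, matA_mul_one,
      matB_inv_mul_zero, matB_inv_mul_one] <;> omega

theorem torsion_entries (n : Fin 4) (k : Fin 6) :
    let N := ((matA * matB * matA) ^ (n : ℕ))⁻¹ * ((matA * matB) ^ (k : ℕ))⁻¹
    1 ≤ N 0 0 → 1 ≤ N 1 1 → 0 ≤ N 0 1 → 0 ≤ N 1 0 →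
      N 0 1 + N 1 0 = 0 ∧ ((n : ℕ) = 0 ∧ (k : ℕ) = 0 ∨ (n : ℕ) = 2 ∧ (k : ℕ) = 3) := by
  dsimp only
  revert n k
  decide +kernel

theorem eq_one_of_matA_matB_normal_form_eq_one {l : List Bool} {n k : ℕ}
    (h : (matA * matB * matA) ^ n * twistWord matA matB l * (matA * matB) ^ k = 1) :
    l = [] ∧ (n % 4 = 0 ∧ k % 6 = 0 ∨ n % 4 = 2 ∧ k % 6 = 3) := by
  have hS : (matA * matB * matA) ^ 4 = 1 := by decide +kernel
  have hU : (matA * matB) ^ 6 = 1 := by decide +kernel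
  rw [pow_eq_pow_mod n hS, pow_eq_pow_mod k hU, mul_eq_one_iff_eq_inv, ← eq_inv_mul_iff_mul_eq] at h
  obtain ⟨h₁, h₂, h₃, h₄, h₅⟩ := twistWord_matA_matB_entries l
  rw [h] at h₁ h₂ h₃ h₄ h₅
  obtain ⟨hsum, hnk⟩ := torsion_entries ⟨n % 4, Nat.mod_lt _ (by norm_num)⟩
    ⟨k % 6, Nat.mod_lt _ (by norm_num)⟩ h₁ h₂ h₃ h₄
  exact ⟨h₅.resolve_right (by rw [hsum]; norm_num), hnk⟩

theorem braid_injective (f : H →* SL2Z) (ha : f a = matA) (hb : f b = matB)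
    (hbraid : a * b * a = b * a * b) (hord : (a * b) ^ 6 = 1)
    (hgen : Subgroup.closure {a, b} = ⊤) : Function.Injective f := by
  refine (injective_iff_map_eq_one f).2 fun h hh => ?_
  obtain ⟨n, k, l, rfl⟩ := exists_braid_normal_form hbraid hord hgen h
  simp only [map_mul, map_pow, map_twistWord, ha, hb] at hh
  obtain ⟨rfl, hnk⟩ := eq_one_of_matA_matB_normal_form_eq_one hh
  have hsq := braid_sq_eq hbraid
  have hs : (a * b * a) ^ 4 = 1 := by
    rw [pow_mul _ 2 2, hsq, ← pow_mul, hord]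
  rw [pow_eq_pow_mod n hs, pow_eq_pow_mod k hord]
  rcases hnk with ⟨hn, hk⟩ | ⟨hn, hk⟩ <;> rw [hn, hk]
  · simp [twistWord]
  · rw [hsq, twistWord, List.map_nil, List.prod_nil, mul_one, ← pow_add, hord]

end ModularGroup

section PuncturedTorus

local notation "x" => FreeGroup.of (0 : Fin 2)
local notation "y" => FreeGroup.of (1 : Fin 2)

/-- The endomorphism of the free group on two generators sending them to `u` and `v`. -/
abbrev freeEnd (u v : FreeGroup (Fin 2)) : FreeGroup (Fin 2) →* FreeGroup (Fin 2) :=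
  FreeGroup.lift ![u, v]

/-- The action of the twist `a` on the fundamental group of the once punctured torus. -/
def autA : MulAut (FreeGroup (Fin 2)) :=
  (freeEnd (x * y) y).toMulEquiv (freeEnd (x * y⁻¹) y)
    (by ext i; fin_cases i <;> simp) (by ext i; fin_cases i <;> simp)

/-- The action of the twist `b` on the fundamental group of the once punctured torus. -/
def autB : MulAut (FreeGroup (Fin 2)) :=
  (freeEnd x (y * x⁻¹)).toMulEquiv (freeEnd x (y * x))
    (by ext i; fin_cases i <;> simp) (by ext i; fin_cases i <;> simp)

/-- The action of the twist `c` on the fundamental group of the once punctured torus. -/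
def autC : MulAut (FreeGroup (Fin 2)) :=
  (freeEnd x (x⁻¹ * y)).toMulEquiv (freeEnd x (x * y))
    (by ext i; fin_cases i <;> simp) (by ext i; fin_cases i <;> simp)

theorem mulAut_ext {σ τ : MulAut (FreeGroup (Fin 2))} (hx : σ x = τ x) (hy : σ y = τ y) :
    σ = τ :=
  MulEquiv.toMonoidHom_injective (FreeGroup.ext_hom _ _ fun i => by fin_cases i <;> assumption)

@[simp] theorem autA_x : autA x = x * y := by simp [autA]
@[simp] theorem autA_y : autA y = y := by simp [autA]
@[simp] theorem autB_x : autB x = x := by simp [autB]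
@[simp] theorem autB_y : autB y = y * x⁻¹ := by simp [autB]
@[simp] theorem autC_x : autC x = x := by simp [autC]
@[simp] theorem autC_y : autC y = x⁻¹ * y := by simp [autC]
@[simp] theorem autA_symm_x : autA.symm x = x * y⁻¹ := by simp [MulEquiv.symm_apply_eq]
@[simp] theorem autA_symm_y : autA.symm y = y := by simp [MulEquiv.symm_apply_eq]
@[simp] theorem autC_symm_x : autC.symm x = x := by simp [MulEquiv.symm_apply_eq]
@[simp] theorem autC_symm_y : autC.symm y = x * y := by simp [MulEquiv.symm_apply_eq]

theorem autA_braid_autB : autA * autB * autA = autB * autA * autB :=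
  mulAut_ext (by simp [mul_assoc]) (by simp [mul_assoc])

theorem autA_braid_autC : autA * autC * autA = autC * autA * autC :=
  mulAut_ext (by simp [mul_assoc]) (by simp [mul_assoc])

theorem autB_comm_autC : autB * autC = autC * autB :=
  mulAut_ext (by simp) (by simp [mul_assoc])

theorem autABC_pow_four : (autA * autB * autC) ^ 4 = 1 :=
  mulAut_ext (by simp [pow_succ, mul_assoc]) (by simp [pow_succ, mul_assoc])

/-- The action of `G` on the fundamental group of the once punctured torus. -/
def pmcgAction : G →* MulAut (FreeGroup (Fin 2)) :=
  PresentedGroup.toGroup (f := ![autA, autB, autC]) (by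
    rintro r (rfl | rfl | rfl | rfl)
    · simp only [map_mul, map_inv, FreeGroup.lift_apply_of]
      simp [autA_braid_autB]
    · simp [autA_braid_autC]
    · simp [autB_comm_autC]
    · simp [autABC_pow_four])

@[simp] theorem pmcgAction_ga : pmcgAction ga = autA := PresentedGroup.toGroup.of _
@[simp] theorem pmcgAction_gb : pmcgAction gb = autB := PresentedGroup.toGroup.of _
@[simp] theorem pmcgAction_gc : pmcgAction gc = autC := PresentedGroup.toGroup.of _

theorem pmcgAction_τm : pmcgAction τm = MulAut.conj x :=
  mulAut_ext (by simp [τm]) (by simp [τm, mul_assoc])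

theorem pmcgAction_τl : pmcgAction τl = MulAut.conj y := by
  rw [τl, map_mul, map_mul, map_mul, map_inv, map_inv, pmcgAction_τm]
  exact mulAut_ext (by simp [mul_assoc]) (by simp [mul_assoc])

/-- The point-pushing homomorphism, sending the free generators to `τm` and `τl`. -/
def push : FreeGroup (Fin 2) →* G := FreeGroup.lift ![τm, τl]

@[simp] theorem push_x : push x = τm := by simp [push]
@[simp] theorem push_y : push y = τl := by simp [push]

theorem pmcgAction_push (w : FreeGroup (Fin 2)) : pmcgAction (push w) = MulAut.conj w := by
  have : pmcgAction.comp push = MulAut.conj := FreeGroup.ext_hom _ _ fun i => by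
    fin_cases i
    · simp [pmcgAction_τm]
    · simp [pmcgAction_τl]
  exact DFunLike.congr_fun this w

theorem push_injective : Function.Injective push := by
  refine (injective_iff_map_eq_one push).2 fun w hw => ?_
  refine FreeGroup.eq_one_of_forall_commute_of fun i => ?_
  have h := DFunLike.congr_fun (pmcgAction_push w) (FreeGroup.of i)
  rw [hw, map_one, MulAut.one_apply, MulAut.conj_apply, eq_mul_inv_iff_mul_eq] at h
  exact h

theorem ga_braid_gb : ga * gb * ga = gb * ga * gb := by
  have : ga * gb * ga * gb⁻¹ * ga⁻¹ * gb⁻¹ = 1 :=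
    PresentedGroup.one_of_mem (rels := pmcgRels) (by simp [pmcgRels])
  simpa [mul_inv_eq_one, mul_inv_eq_iff_eq_mul] using this

theorem ga_braid_gc : ga * gc * ga = gc * ga * gc := by
  have : ga * gc * ga * gc⁻¹ * ga⁻¹ * gc⁻¹ = 1 :=
    PresentedGroup.one_of_mem (rels := pmcgRels) (by simp [pmcgRels])
  simpa [mul_inv_eq_one, mul_inv_eq_iff_eq_mul] using this

theorem gb_comm_gc : gb * gc = gc * gb := by
  have : gb * gc * gb⁻¹ * gc⁻¹ = 1 :=
    PresentedGroup.one_of_mem (rels := pmcgRels) (by simp [pmcgRels])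
  simpa [mul_inv_eq_one, mul_inv_eq_iff_eq_mul] using this

theorem gabc_pow_four : (ga * gb * gc) ^ 4 = 1 :=
  PresentedGroup.one_of_mem (rels := pmcgRels) (by simp [pmcgRels])

theorem ga_τm_conj : ga * τm * ga⁻¹ = τm * τl := by
  simp [τl, mul_assoc]

theorem commute_gb_τm : Commute gb τm :=
  (Commute.refl gb).mul_right (Commute.inv_right gb_comm_gc)

theorem gb_τm_conj : gb * τm * gb⁻¹ = τm := by
  rw [commute_gb_τm.eq, mul_inv_cancel_right]

theorem gb_τl_conj : gb * τl * gb⁻¹ = τl * τm⁻¹ := by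
  have hc : ga * gc⁻¹ * ga⁻¹ = gc⁻¹ * ga⁻¹ * gc := by
    rw [mul_inv_eq_iff_eq_mul, mul_assoc, mul_assoc, eq_inv_mul_iff_mul_eq,
      eq_inv_mul_iff_mul_eq, ← mul_assoc, ← mul_assoc, mul_inv_eq_iff_eq_mul, ga_braid_gc]
  have h : gb * ga * τm * ga⁻¹ * gb⁻¹ = ga * τm * ga⁻¹ * τm⁻¹ := by
    calc gb * ga * τm * ga⁻¹ * gb⁻¹ = gb * ga * gb * gc⁻¹ * ga⁻¹ * gb⁻¹ := by
          simp only [τm, mul_assoc]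
      _ = ga * gb * (ga * gc⁻¹ * ga⁻¹) * gb⁻¹ := by rw [← ga_braid_gb]; simp only [mul_assoc]
      _ = ga * τm * ga⁻¹ * τm⁻¹ := by
          rw [hc]; simp only [τm, mul_inv_rev, inv_inv, mul_assoc]
  calc gb * τl * gb⁻¹ = gb * τm⁻¹ * (ga * τm * ga⁻¹ * gb⁻¹) := by simp only [τl, mul_assoc]
    _ = τm⁻¹ * (gb * ga * τm * ga⁻¹ * gb⁻¹) := by
        rw [commute_gb_τm.inv_right.eq]; simp only [mul_assoc]
    _ = τl * τm⁻¹ := by rw [h]; simp only [τl, mul_assoc]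

theorem ga_τl_conj : ga * τl * ga⁻¹ = τl := by
  have h : MulAut.conj (ga * gb * ga) τm = MulAut.conj (gb * ga * gb) τm := by rw [ga_braid_gb]
  have hA : MulAut.conj ga τm = τm * τl := ga_τm_conj
  have hB : MulAut.conj gb τm = τm := gb_τm_conj
  have hB' : MulAut.conj gb τl = τl * τm⁻¹ := gb_τl_conj
  simp only [map_mul, map_inv, MulAut.mul_apply, hA, hB, hB'] at h
  rwa [← mul_assoc τm τl τm⁻¹, mul_right_inj, mul_inv_eq_iff_eq_mul, inv_mul_cancel_left] at h

theorem gc_eq : gc = τm⁻¹ * gb := by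
  simp [τm]

theorem gc_τm_conj : gc * τm * gc⁻¹ = τm := by
  have h : Commute gc τm := gc_eq ▸ (Commute.refl τm).inv_left.mul_left commute_gb_τm
  rw [h.eq, mul_inv_cancel_right]

theorem gc_τl_conj : gc * τl * gc⁻¹ = τm⁻¹ * τl := by
  calc gc * τl * gc⁻¹ = τm⁻¹ * (gb * τl * gb⁻¹) * τm := by
        rw [gc_eq]; simp only [mul_inv_rev, inv_inv, mul_assoc]
    _ = τm⁻¹ * τl := by rw [gb_τl_conj]; simp only [mul_assoc, inv_mul_cancel, mul_one]

theorem push_pmcgAction (g : G) (w : FreeGroup (Fin 2)) :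
    push (pmcgAction g w) = g * push w * g⁻¹ := by
  have hg : g ∈ Subgroup.closure (Set.range PresentedGroup.of) := by
    rw [PresentedGroup.closure_range_of]; trivial
  have key (s : G) (σ : MulAut (FreeGroup (Fin 2))) (hσ : pmcgAction s = σ)
      (hx : push (σ x) = s * push x * s⁻¹) (hy : push (σ y) = s * push y * s⁻¹)
      (w : FreeGroup (Fin 2)) : push (pmcgAction s w) = s * push w * s⁻¹ := by
    have : push.comp (pmcgAction s).toMonoidHom = (MulAut.conj s).toMonoidHom.comp push :=
      FreeGroup.ext_hom _ _ fun i => by subst hσ; fin_cases i <;> assumption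
    exact DFunLike.congr_fun this w
  induction hg using Subgroup.closure_induction generalizing w with
  | mem s hs =>
    obtain ⟨i, rfl⟩ := hs
    fin_cases i
    · exact key ga _ pmcgAction_ga (by simp [ga_τm_conj]) (by simp [ga_τl_conj]) w
    · exact key gb _ pmcgAction_gb (by simp [gb_τm_conj]) (by simp [gb_τl_conj]) w
    · exact key gc _ pmcgAction_gc (by simp [gc_τm_conj]) (by simp [gc_τl_conj]) w
  | one => simp
  | mul g h _ _ ihg ihh =>
    rw [map_mul, MulAut.mul_apply, ihg, ihh]
    simp only [mul_inv_rev, mul_assoc]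
  | inv g _ ih =>
    have := ih (pmcgAction g⁻¹ w)
    rw [map_inv, MulAut.apply_inv_self] at this
    rw [map_inv, this]
    simp [mul_assoc]

instance normal_range_push : push.range.Normal where
  conj_mem := by
    rintro _ ⟨w, rfl⟩ g
    exact ⟨pmcgAction g w, push_pmcgAction g w⟩

theorem mk_gc : (gc : G ⧸ push.range) = gb :=
  (QuotientGroup.eq_iff_div_mem.2 ⟨x, by simp [τm, div_eq_mul_inv]⟩ :
    (gb : G ⧸ push.range) = gc).symm

theorem closure_quotient_range_push :
    Subgroup.closure {(ga : G ⧸ push.range), (gb : G ⧸ push.range)} = ⊤ := by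
  rw [eq_top_iff]
  rintro ⟨g⟩ -
  refine PresentedGroup.generated_by pmcgRels
    ((Subgroup.closure {(ga : G ⧸ push.range), (gb : G ⧸ push.range)}).comap
      (QuotientGroup.mk' push.range)) (fun i => ?_) g
  fin_cases i
  · exact Subgroup.subset_closure (Or.inl rfl)
  · exact Subgroup.subset_closure (Or.inr rfl)
  · exact Subgroup.subset_closure (Or.inr mk_gc)

theorem range_push_eq_ker (Ω : G →* SL2Z) (ha : Ω ga = matA) (hb : Ω gb = matB)
    (hc : Ω gc = matB) : push.range = Ω.ker := by
  have hle : push.range ≤ Ω.ker := by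
    have hm : Ω τm = 1 := by simp [τm, hb, hc]
    have hl : Ω τl = 1 := by simp [τl, hm]
    have : Ω.comp push = 1 := FreeGroup.ext_hom _ _ fun i => by
      fin_cases i
      · simpa using hm
      · simpa using hl
    rintro _ ⟨w, rfl⟩
    exact DFunLike.congr_fun this w
  refine le_antisymm hle fun g hg => ?_
  have hbraid : (ga * gb * ga : G ⧸ push.range) = gb * ga * gb :=
    congrArg (QuotientGroup.mk' push.range) ga_braid_gb
  have hord : (ga * gb : G ⧸ push.range) ^ 6 = 1 := by
    have h : (ga * gb * gb : G ⧸ push.range) ^ 4 = 1 := by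
      have := congrArg (QuotientGroup.mk' push.range) gabc_pow_four
      simpa [mk_gc] using this
    have hsq : (ga * gb * gb : G ⧸ push.range) ^ 2 = (ga * gb) ^ 3 := by
      calc (ga * gb * gb : G ⧸ push.range) ^ 2 = ga * gb * (gb * ga * gb) * gb := by
            simp only [pow_two, mul_assoc]
        _ = (ga * gb) ^ 3 := by
            rw [← hbraid]; simp only [pow_succ, pow_zero, one_mul, mul_assoc]
    rw [pow_mul _ 3 2, ← hsq, ← pow_mul, h]
  have hinj := braid_injective (QuotientGroup.lift push.range Ω hle) (a := (ga : G ⧸ push.range))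
    (b := (gb : G ⧸ push.range)) ha hb
    hbraid hord closure_quotient_range_push
  rw [← QuotientGroup.eq_one_iff]
  exact hinj ((QuotientGroup.lift_mk' _ hle g).trans (hg.trans (map_one _).symm))

end PuncturedTorus

theorem stmt2 (Ω : G →* SL2Z) (ha : Ω ga = matA) (hb : Ω gb = matB)
    (hc : Ω gc = matB) :
    ∃ e : FreeGroup (Fin 2) ≃* Ω.ker,
      ((e (FreeGroup.of 0) : Ω.ker) : G) = τm ∧
      ((e (FreeGroup.of 1) : Ω.ker) : G) = τl :=
  ⟨(MonoidHom.ofInjective push_injective).trans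
    (MulEquiv.subgroupCongr (range_push_eq_ker Ω ha hb hc)), push_x, push_y⟩
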